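/- Let n ≥ 1, Q = 2n+2, and suppose 1 < p < ∞, 1 < q' < ∞, q is the Hölder conjugate of q' (1/q + 1/q' = 1), p' is the Hölder conjugate of p, 0 < λ < Q, α + β ≥ 0, λ + α + β ≤ Q, β < Q/p', α < Q/q, and 1/p + 1/q' + (λ+α+β)/Q = 2. Then there exists a constant C_{Q,α,β,p,q'} > 0 such that for all f ∈ L^{q'}(ℍⁿ) and g ∈ L^{p}(ℍⁿ), ∫_{ℍⁿ}∫_{ℍⁿ} |f(u)| |g(v)| / ( |u|^{α} |u⁻¹v|^{λ} |v|^{β} ) dv du ≤ C_{Q,α,β,p,q'} ‖f‖_{L^{q'}(ℍⁿ)} ‖g‖_{L^{p}(ℍⁿ)}. -/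

import Mathlib

open MeasureTheory ENNReal Filter

noncomputable section

/-- The Heisenberg group `ℍⁿ = ℂⁿ × ℝ` (as a measure space, with Lebesgue/Haar measure). -/
abbrev Hn (n : ℕ) := (Fin n → ℂ) × ℝ

/-- Euclidean norm of the `ℂⁿ` component. -/
def znorm {n : ℕ} (z : Fin n → ℂ) : ℝ := Real.sqrt (∑ j, Complex.normSq (z j))

/-- Homogeneous norm `|u| = (|z|⁴ + t²)^{1/4}` on the Heisenberg group. -/
def Hnorm {n : ℕ} (u : Hn n) : ℝ := (znorm u.1 ^ 4 + u.2 ^ 2) ^ ((1 : ℝ)/4)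

/-- Heisenberg group law `(z,t)·(z',t') = (z+z', t+t'+2 Im (z ⬝ conj z'))`. -/
def Hmul {n : ℕ} (u v : Hn n) : Hn n :=
  (u.1 + v.1, u.2 + v.2 + 2 * (∑ j, u.1 j * (starRingEnd ℂ) (v.1 j)).im)

/-- Heisenberg group inverse `(z,t)⁻¹ = (-z,-t)`. -/
def Hinv {n : ℕ} (u : Hn n) : Hn n := (-u.1, -u.2)

/-- Left-invariant quasi-distance `d(u,v) = |u⁻¹ v|`. -/
def Hdist {n : ℕ} (u v : Hn n) : ℝ := Hnorm (Hmul (Hinv u) v)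

/-- Heisenberg ball `B_ℍ(u,R)`. -/
def Hball {n : ℕ} (u : Hn n) (R : ℝ) : Set (Hn n) := {v | Hdist u v < R}

/-- Fractional integral operator `I_λ(g)(u) = ∫ g(v)/|u⁻¹v|^λ dv`. -/
def Ilam {n : ℕ} (lam : ℝ) (g : Hn n → ℝ) (u : Hn n) : ℝ :=
  ∫ v, g v / Hdist u v ^ lam

/-- The sublevel sets `{ρ < R}` have measure at most `c * R ^ Q`. -/
structure HasBallBound {X : Type*} [MeasurableSpace X] (μ : Measure X) (Q c : ℝ) (ρ : X → ℝ) :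
    Prop where
  measurable : Measurable ρ
  measure_lt_le : ∀ R : ℝ, 0 < R → μ {x | ρ x < R} ≤ ENNReal.ofReal (c * R ^ Q)

section Abstract

variable {X : Type*} [MeasurableSpace X] {μ : Measure X}

lemma rpow_neg_le_of_mem_annulus {x t M : ℝ} (γ : ℝ) (ht : 0 < t) (h1 : t ≤ x) (h2 : x ≤ M * t) :
    x ^ (-γ) ≤ M ^ |γ| * t ^ (-γ) := by
  have hx : 0 < x := ht.trans_le h1
  have h3 : 1 ≤ x / t := (one_le_div ht).2 h1
  have h4 : x / t ≤ M := (div_le_iff₀ ht).2 h2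
  have h5 : (x / t) ^ (-γ) ≤ M ^ |γ| :=
    (Real.rpow_le_rpow_of_exponent_le h3 (neg_le_abs γ)).trans
      (Real.rpow_le_rpow (by positivity) h4 (abs_nonneg γ))
  rw [Real.div_rpow hx.le ht.le] at h5
  exact (div_le_iff₀ (by positivity)).1 h5

lemma lintegral_indicator_rpow_le_of_annuli {Q c b γ : ℝ} (hc : 0 ≤ c) (hb : 0 < b)
    (hb1 : b ^ (Q - γ) < 1) :
    ∃ C : ℝ, 0 ≤ C ∧ ∀ ρ : X → ℝ, HasBallBound μ Q c ρ → ∀ R : ℝ, 0 < R → ∀ S : Set X,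
      (∀ x ∈ S, ∃ k : ℕ, R * b ^ k ≤ ρ x ∧ ρ x < 2 * (R * b ^ k)) →
      ∫⁻ x, S.indicator (fun x => ENNReal.ofReal (ρ x ^ (-γ))) x ∂μ ≤
        ENNReal.ofReal (C * R ^ (Q - γ)) := by
  refine ⟨2 ^ |γ| * c * 2 ^ Q * (1 - b ^ (Q - γ))⁻¹, ?_, ?_⟩
  · have : 0 ≤ 1 - b ^ (Q - γ) := by linarith
    positivity
  intro ρ hρ R hR S hS
  have hpt : ∀ x, S.indicator (fun x => ENNReal.ofReal (ρ x ^ (-γ))) x ≤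
      ∑' k : ℕ, {x | ρ x < 2 * (R * b ^ k)}.indicator
        (fun _ => ENNReal.ofReal (2 ^ |γ| * (R * b ^ k) ^ (-γ))) x := by
    intro x
    by_cases hx : x ∈ S
    · obtain ⟨k, hk1, hk2⟩ := hS x hx
      refine le_trans ?_ (ENNReal.le_tsum k)
      rw [Set.indicator_of_mem hx, Set.indicator_of_mem (by exact hk2)]
      exact ENNReal.ofReal_le_ofReal
        (rpow_neg_le_of_mem_annulus γ (by positivity) hk1 hk2.le)
    · simp [Set.indicator_of_notMem hx]
  have hm : ∀ k : ℕ, MeasurableSet {x | ρ x < 2 * (R * b ^ k)} := fun k =>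
    measurableSet_lt hρ.measurable measurable_const
  calc ∫⁻ x, S.indicator (fun x => ENNReal.ofReal (ρ x ^ (-γ))) x ∂μ
      ≤ ∫⁻ x, ∑' k : ℕ, {x | ρ x < 2 * (R * b ^ k)}.indicator
        (fun _ => ENNReal.ofReal (2 ^ |γ| * (R * b ^ k) ^ (-γ))) x ∂μ := lintegral_mono hpt
    _ = ∑' k : ℕ, ENNReal.ofReal (2 ^ |γ| * (R * b ^ k) ^ (-γ)) *
          μ {x | ρ x < 2 * (R * b ^ k)} := by
        rw [lintegral_tsum fun k => (measurable_const.indicator (hm k)).aemeasurable]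
        congr 1 with k
        rw [lintegral_indicator_const (hm k)]
    _ ≤ ∑' k : ℕ, ENNReal.ofReal
          (2 ^ |γ| * c * 2 ^ Q * R ^ (Q - γ) * (b ^ (Q - γ)) ^ k) := by
        refine ENNReal.tsum_le_tsum fun k => ?_
        refine (mul_le_mul_right (hρ.measure_lt_le _ (by positivity)) _).trans ?_
        rw [← ENNReal.ofReal_mul (by positivity)]
        refine ENNReal.ofReal_le_ofReal (le_of_eq ?_)
        have e1 : (2 * (R * b ^ k)) ^ Q = 2 ^ Q * (R * b ^ k) ^ Q :=
          Real.mul_rpow (by norm_num) (by positivity)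
        have e2 : (R * b ^ k) ^ (-γ) * (R * b ^ k) ^ Q = R ^ (Q - γ) * (b ^ (Q - γ)) ^ k := by
          rw [← Real.rpow_add (by positivity), Real.mul_rpow hR.le (by positivity),
            ← Real.rpow_natCast, ← Real.rpow_natCast, ← Real.rpow_mul hb.le,
            ← Real.rpow_mul hb.le, neg_add_eq_sub, mul_comm (k : ℝ)]
        rw [e1]
        linear_combination 2 ^ |γ| * c * 2 ^ Q * e2
    _ = ENNReal.ofReal (2 ^ |γ| * c * 2 ^ Q * (1 - b ^ (Q - γ))⁻¹ * R ^ (Q - γ)) := by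
        have hb0 : 0 ≤ b ^ (Q - γ) := by positivity
        rw [← ENNReal.ofReal_tsum_of_nonneg (fun k => by positivity)
          ((summable_geometric_of_lt_one hb0 hb1).mul_left _), tsum_mul_left,
          tsum_geometric_of_lt_one hb0 hb1]
        congr 1
        ring

lemma lintegral_rpow_inner_le {Q c γ : ℝ} (hc : 0 ≤ c) (hγ : γ < Q) :
    ∃ C : ℝ, 0 ≤ C ∧ ∀ ρ : X → ℝ, HasBallBound μ Q c ρ → ∀ R : ℝ, 0 < R →
      ∫⁻ x, {x | 0 < ρ x ∧ ρ x ≤ R}.indicator (fun x => ENNReal.ofReal (ρ x ^ (-γ))) x ∂μ ≤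
        ENNReal.ofReal (C * R ^ (Q - γ)) := by
  obtain ⟨C, hC, h⟩ := lintegral_indicator_rpow_le_of_annuli (μ := μ) (b := 1 / 2) (γ := γ) (Q := Q)
    hc (by norm_num) (Real.rpow_lt_one (by norm_num) (by norm_num) (by linarith))
  refine ⟨C, hC, fun ρ hρ R hR => h ρ hρ R hR _ ?_⟩
  rintro x ⟨hx0, hxR⟩
  obtain ⟨k, hk1, hk2⟩ := exists_nat_pow_near_of_lt_one (x := ρ x / R) (y := 1 / 2)
    (by positivity) ((div_le_one hR).2 hxR) (by norm_num) (by norm_num)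
  rw [lt_div_iff₀ hR] at hk1
  rw [div_le_iff₀ hR] at hk2
  rcases hk2.lt_or_eq with h2 | h2
  · refine ⟨k + 1, by linarith, ?_⟩
    rw [pow_succ]; linarith
  · have : 0 < R * (1 / 2 : ℝ) ^ k := by positivity
    exact ⟨k, by linarith, by linarith⟩

lemma lintegral_rpow_outer_le {Q c γ : ℝ} (hc : 0 ≤ c) (hγ : Q < γ) :
    ∃ C : ℝ, 0 ≤ C ∧ ∀ ρ : X → ℝ, HasBallBound μ Q c ρ → ∀ R : ℝ, 0 < R →
      ∫⁻ x, {x | R ≤ ρ x}.indicator (fun x => ENNReal.ofReal (ρ x ^ (-γ))) x ∂μ ≤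
        ENNReal.ofReal (C * R ^ (Q - γ)) := by
  obtain ⟨C, hC, h⟩ := lintegral_indicator_rpow_le_of_annuli (μ := μ) (b := 2) (γ := γ) (Q := Q)
    hc (by norm_num) (Real.rpow_lt_one_of_one_lt_of_neg (by norm_num) (by linarith))
  refine ⟨C, hC, fun ρ hρ R hR => h ρ hρ R hR _ ?_⟩
  intro x hx
  obtain ⟨k, hk1, hk2⟩ := exists_nat_pow_near (x := ρ x / R) (y := 2)
    ((one_le_div hR).2 hx) (by norm_num)
  rw [le_div_iff₀ hR] at hk1
  rw [div_lt_iff₀ hR, pow_succ] at hk2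
  exact ⟨k, by linarith, by linarith⟩

/-- A Schur-type test with three exponents `a + b + c = 1`. -/
lemma lintegral_mul_kernel_le_of_schur [SFinite μ] {p r a b c C₁ C₂ : ℝ} (hp : 0 < p) (hr : 0 < r)
    (ha : 0 ≤ a) (hb : 0 ≤ b) (hc : 0 ≤ c) (habc : a + b + c = 1)
    (hra : a + c = 1 / r) (hpb : b + c = 1 / p) {F G : X → ℝ≥0∞} (hF : Measurable F)
    (hG : Measurable G) {k k₁ k₂ : X × X → ℝ≥0∞} (hk₁ : Measurable k₁)
    (hk₂ : Measurable k₂) (hk : ∀ z, k z ≤ k₁ z ^ a * k₂ z ^ b)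
    (h₁ : ∀ u, ∫⁻ v, k₁ (u, v) ∂μ ≤ ENNReal.ofReal C₁)
    (h₂ : ∀ v, ∫⁻ u, k₂ (u, v) ∂μ ≤ ENNReal.ofReal C₂) :
    ∫⁻ z, F z.1 * G z.2 * k z ∂(μ.prod μ) ≤ ENNReal.ofReal C₁ ^ a * ENNReal.ofReal C₂ ^ b *
      (∫⁻ u, F u ^ r ∂μ) ^ (1 / r) * (∫⁻ v, G v ^ p ∂μ) ^ (1 / p) := by
  set A := ∫⁻ u, F u ^ r ∂μ with hA
  set B := ∫⁻ v, G v ^ p ∂μ with hB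
  let w : Fin 3 → ℝ := ![a, b, c]
  let φ : Fin 3 → X × X → ℝ≥0∞ :=
    ![fun z => F z.1 ^ r * k₁ z, fun z => G z.2 ^ p * k₂ z, fun z => F z.1 ^ r * G z.2 ^ p]
  have hFr : Measurable fun u => F u ^ r := hF.pow_const r
  have hGp : Measurable fun u => G u ^ p := hG.pow_const p
  have hFr1 : Measurable fun z : X × X => F z.1 ^ r := hFr.comp measurable_fst
  have hGp2 : Measurable fun z : X × X => G z.2 ^ p := hGp.comp measurable_snd
  have hφ : ∀ i ∈ Finset.univ, AEMeasurable (φ i) (μ.prod μ) := by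
    intro i _
    fin_cases i
    · exact (hFr1.mul hk₁).aemeasurable
    · exact (hGp2.mul hk₂).aemeasurable
    · exact (hFr1.mul hGp2).aemeasurable
  have hold := ENNReal.lintegral_prod_norm_pow_le (μ := μ.prod μ) Finset.univ (f := φ) hφ (p := w)
    (by simp [w, Fin.sum_univ_three, habc])
    (by intro i _; fin_cases i <;> simp [w, ha, hb, hc])
  simp only [Fin.prod_univ_three, φ, w, Matrix.cons_val_zero, Matrix.cons_val_one,
    Matrix.cons_val] at hold
  have i1 : ∫⁻ z, F z.1 ^ r * k₁ z ∂(μ.prod μ) ≤ A * ENNReal.ofReal C₁ := by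
    have hm : Measurable fun z => F z.1 ^ r * k₁ z := hFr1.mul hk₁
    rw [lintegral_prod _ hm.aemeasurable, hA, ← lintegral_mul_const _ hFr]
    refine lintegral_mono fun u => ?_
    dsimp only
    have hs : Measurable fun v => k₁ (u, v) := hk₁.comp measurable_prodMk_left
    rw [lintegral_const_mul _ hs]
    gcongr
    exact h₁ u
  have i2 : ∫⁻ z, G z.2 ^ p * k₂ z ∂(μ.prod μ) ≤ B * ENNReal.ofReal C₂ := by
    have hm : Measurable fun z => G z.2 ^ p * k₂ z := hGp2.mul hk₂
    rw [lintegral_prod_symm _ hm.aemeasurable, hB, ← lintegral_mul_const _ hGp]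
    refine lintegral_mono fun u => ?_
    dsimp only
    have hs : Measurable fun v => k₂ (v, u) := hk₂.comp measurable_prodMk_right
    rw [lintegral_const_mul _ hs]
    gcongr
    exact h₂ u
  have i3 : ∫⁻ z : X × X, F z.1 ^ r * G z.2 ^ p ∂(μ.prod μ) = A * B :=
    lintegral_prod_mul hFr.aemeasurable hGp.aemeasurable
  have split : ∀ (x : ℝ≥0∞) (s e e' : ℝ), 0 < s → 0 ≤ e → 0 ≤ e' → e + e' = 1 / s →
      (x ^ s) ^ e * (x ^ s) ^ e' = x := by
    intro x s e e' hs he he' h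
    rw [← ENNReal.rpow_add_of_nonneg _ _ he he', h, ← ENNReal.rpow_mul, mul_one_div_cancel hs.ne',
      ENNReal.rpow_one]
  calc ∫⁻ z, F z.1 * G z.2 * k z ∂(μ.prod μ)
      ≤ ∫⁻ z, (F z.1 ^ r * k₁ z) ^ a * (G z.2 ^ p * k₂ z) ^ b *
          (F z.1 ^ r * G z.2 ^ p) ^ c ∂(μ.prod μ) := by
        refine lintegral_mono fun z => ?_
        simp only
        rw [ENNReal.mul_rpow_of_nonneg _ _ ha, ENNReal.mul_rpow_of_nonneg _ _ hb,
          ENNReal.mul_rpow_of_nonneg _ _ hc]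
        calc F z.1 * G z.2 * k z ≤ F z.1 * G z.2 * (k₁ z ^ a * k₂ z ^ b) := by gcongr; exact hk z
          _ = ((F z.1 ^ r) ^ a * (F z.1 ^ r) ^ c) * ((G z.2 ^ p) ^ b * (G z.2 ^ p) ^ c) *
              (k₁ z ^ a * k₂ z ^ b) := by
            rw [split _ r a c hr ha hc hra, split _ p b c hp hb hc hpb]
          _ = _ := by ring
    _ ≤ (A * ENNReal.ofReal C₁) ^ a * (B * ENNReal.ofReal C₂) ^ b * (A * B) ^ c := by
        refine hold.trans ?_
        rw [i3]
        gcongr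
    _ = ENNReal.ofReal C₁ ^ a * ENNReal.ofReal C₂ ^ b * A ^ (1 / r) * B ^ (1 / p) := by
        rw [ENNReal.mul_rpow_of_nonneg _ _ ha, ENNReal.mul_rpow_of_nonneg _ _ hb,
          ENNReal.mul_rpow_of_nonneg _ _ hc, ← hra, ← hpb,
          ENNReal.rpow_add_of_nonneg _ _ ha hc, ENNReal.rpow_add_of_nonneg _ _ hb hc]
        ring
/-- Boundedness on `L^r × L^p` of the bilinear form with nonnegative kernel `k`. -/
def KernelBounded (μ : Measure X) (r p : ℝ) (k : X × X → ℝ≥0∞) : Prop :=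
  ∃ C : ℝ≥0∞, C ≠ ⊤ ∧ ∀ F G : X → ℝ≥0∞, Measurable F → Measurable G →
    ∫⁻ u, F u ^ r ∂μ ≠ ⊤ → ∫⁻ v, G v ^ p ∂μ ≠ ⊤ →
    ∫⁻ z, F z.1 * G z.2 * k z ∂(μ.prod μ) ≤
      C * (∫⁻ u, F u ^ r ∂μ) ^ (1 / r) * (∫⁻ v, G v ^ p ∂μ) ^ (1 / p)

lemma KernelBounded.add {r p : ℝ} {k k' : X × X → ℝ≥0∞} (h : KernelBounded μ r p k)
    (h' : KernelBounded μ r p k') (hk : Measurable k) :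
    KernelBounded μ r p fun z => k z + k' z := by
  obtain ⟨C, hC, h⟩ := h
  obtain ⟨C', hC', h'⟩ := h'
  refine ⟨C + C', by simp [hC, hC'], fun F G hF hG hA hB => ?_⟩
  have hm : Measurable fun z : X × X => F z.1 * G z.2 * k z :=
    ((hF.comp measurable_fst).mul (hG.comp measurable_snd)).mul hk
  simp only [mul_add, add_mul]
  rw [lintegral_add_left hm]
  exact add_le_add (h F G hF hG hA hB) (h' F G hF hG hA hB)

lemma KernelBounded.mono_mul {r p D : ℝ} {k k' : X × X → ℝ≥0∞} (h : KernelBounded μ r p k)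
    (hk : ∀ z, k' z ≤ ENNReal.ofReal D * k z) : KernelBounded μ r p k' := by
  obtain ⟨C, hC, h⟩ := h
  refine ⟨ENNReal.ofReal D * C, ENNReal.mul_ne_top ENNReal.ofReal_ne_top hC,
    fun F G hF hG hA hB => ?_⟩
  calc ∫⁻ z, F z.1 * G z.2 * k' z ∂(μ.prod μ)
      ≤ ∫⁻ z, ENNReal.ofReal D * (F z.1 * G z.2 * k z) ∂(μ.prod μ) := by
        refine lintegral_mono fun z => ?_
        dsimp only
        rw [mul_left_comm]
        gcongr
        exact hk z
    _ = ENNReal.ofReal D * ∫⁻ z, F z.1 * G z.2 * k z ∂(μ.prod μ) :=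
        lintegral_const_mul' _ _ ENNReal.ofReal_ne_top
    _ ≤ ENNReal.ofReal D * (C * (∫⁻ u, F u ^ r ∂μ) ^ (1 / r) * (∫⁻ v, G v ^ p ∂μ) ^ (1 / p)) := by
        gcongr
        exact h F G hF hG hA hB
    _ = _ := by ring

lemma KernelBounded.swap [SFinite μ] {r p : ℝ} {k : X × X → ℝ≥0∞} (h : KernelBounded μ r p k) :
    KernelBounded μ p r fun z => k z.swap := by
  obtain ⟨C, hC, h⟩ := h
  refine ⟨C, hC, fun F G hF hG hA hB => ?_⟩
  have := h G F hG hF hB hA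
  rw [← lintegral_prod_swap] at this
  calc _ = ∫⁻ z : X × X, G z.swap.1 * F z.swap.2 * k z.swap ∂(μ.prod μ) := by
        refine lintegral_congr fun z => ?_
        simp only [Prod.fst_swap, Prod.snd_swap]
        ring
    _ ≤ _ := this
    _ = _ := by ring

lemma lintegral_le_of_le_indicator {T : Set X} {f : X → ℝ≥0∞} {g : X → ℝ} {D C C' : ℝ}
    (hD : 0 ≤ D)
    (hT : ∫⁻ x, T.indicator (fun x => ENNReal.ofReal (g x)) x ∂μ ≤ ENNReal.ofReal C)
    (hf : ∀ x, f x ≠ 0 → x ∈ T ∧ f x ≤ ENNReal.ofReal (D * g x)) (hC : D * C = C') :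
    ∫⁻ x, f x ∂μ ≤ ENNReal.ofReal C' := by
  calc ∫⁻ x, f x ∂μ
      ≤ ∫⁻ x, ENNReal.ofReal D * T.indicator (fun x => ENNReal.ofReal (g x)) x ∂μ := by
        refine lintegral_mono fun x => ?_
        by_cases hx : f x = 0
        · simp [hx]
        · obtain ⟨h1, h2⟩ := hf x hx
          rwa [Set.indicator_of_mem h1, ← ENNReal.ofReal_mul hD]
    _ = ENNReal.ofReal D * ∫⁻ x, T.indicator (fun x => ENNReal.ofReal (g x)) x ∂μ :=
        lintegral_const_mul' _ _ ENNReal.ofReal_ne_top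
    _ ≤ ENNReal.ofReal D * ENNReal.ofReal C := by gcongr
    _ = ENNReal.ofReal C' := by rw [← ENNReal.ofReal_mul hD, hC]

/-- A Hardy inequality: the kernel `ρ(u)^(-α) ρ(v)^(α-σ)` restricted to `ρ(u) ≤ ρ(v)`. -/
lemma kernelBounded_hardy [SFinite μ] {Q c p r α σ : ℝ} {ρ : X → ℝ} (hc : 0 ≤ c)
    (hρ : HasBallBound μ Q c ρ) (hp : 1 < p) (hr : 1 < r) (hpr : 1 ≤ 1 / p + 1 / r)
    (hα : α < Q * (1 - 1 / r)) (hσ : σ = Q * (2 - 1 / p - 1 / r)) :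
    KernelBounded μ r p ({z : X × X | 0 < ρ z.1 ∧ ρ z.1 ≤ ρ z.2}.indicator
      fun z => ENNReal.ofReal (ρ z.1 ^ (-α) * ρ z.2 ^ (α - σ))) := by
  have ha : 0 < 1 - 1 / p := by rw [sub_pos, div_lt_one] <;> linarith
  have hb : 0 < 1 - 1 / r := by rw [sub_pos, div_lt_one] <;> linarith
  set a := 1 - 1 / p with ha_def
  set b := 1 - 1 / r with hb_def
  have hab : 0 < a + b := add_pos ha hb
  obtain ⟨ε, hε, hεe⟩ : ∃ ε : ℝ, 0 < ε ∧ ε * (a + b) = Q * b - α :=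
    ⟨(Q * b - α) / (a + b), div_pos (by linarith) hab, div_mul_cancel₀ _ hab.ne'⟩
  set S : Set (X × X) := {z : X × X | 0 < ρ z.1 ∧ ρ z.1 ≤ ρ z.2} with hS
  have hm1 : Measurable fun z : X × X => ρ z.1 := hρ.measurable.comp measurable_fst
  have hm2 : Measurable fun z : X × X => ρ z.2 := hρ.measurable.comp measurable_snd
  have hSm : MeasurableSet S :=
    (measurableSet_lt measurable_const hm1).inter (measurableSet_le hm1 hm2)
  obtain ⟨C₁, hC₁, h₁⟩ := lintegral_rpow_outer_le (μ := μ) (Q := Q) (γ := Q + ε) hc (by linarith)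
  obtain ⟨C₂, hC₂, h₂⟩ := lintegral_rpow_inner_le (μ := μ) (Q := Q) (γ := Q - ε) hc (by linarith)
  refine ⟨ENNReal.ofReal C₁ ^ a * ENNReal.ofReal C₂ ^ b, by finiteness,
    fun F G hF hG _ _ => ?_⟩
  refine lintegral_mul_kernel_le_of_schur (c := 1 / p + 1 / r - 1)
    (k₁ := S.indicator fun z => ENNReal.ofReal (ρ z.1 ^ ε * ρ z.2 ^ (-(Q + ε))))
    (k₂ := S.indicator fun z => ENNReal.ofReal (ρ z.1 ^ (-(Q - ε)) * ρ z.2 ^ (-ε)))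
    (by linarith) (by linarith) ha.le hb.le (by linarith) (by linarith) (by linarith)
    (by linarith) hF hG
    (((hm1.pow_const _).mul (hm2.pow_const _)).ennreal_ofReal.indicator hSm)
    (((hm1.pow_const _).mul (hm2.pow_const _)).ennreal_ofReal.indicator hSm)
    ?_ ?_ ?_
  · intro z
    by_cases hz : z ∈ S
    · have hx : 0 < ρ z.1 := hz.1
      have hy : 0 < ρ z.2 := hx.trans_le hz.2
      simp only [Set.indicator_of_mem hz]
      rw [ENNReal.ofReal_rpow_of_pos (by positivity), ENNReal.ofReal_rpow_of_pos (by positivity),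
        ← ENNReal.ofReal_mul (by positivity)]
      refine ENNReal.ofReal_le_ofReal (le_of_eq ?_)
      rw [Real.mul_rpow (by positivity) (by positivity),
        Real.mul_rpow (by positivity) (by positivity), ← Real.rpow_mul hx.le,
        ← Real.rpow_mul hx.le, ← Real.rpow_mul hy.le, ← Real.rpow_mul hy.le,
        mul_mul_mul_comm, ← Real.rpow_add hx, ← Real.rpow_add hy]
      congr 2
      · linear_combination -hεe
      · rw [hσ]
        linear_combination hεe
    · simp [Set.indicator_of_notMem hz]
  · intro u
    by_cases hu : 0 < ρ u
    · refine lintegral_le_of_le_indicator (Real.rpow_nonneg hu.le ε) (h₁ ρ hρ _ hu) (fun v hv => ?_) ?_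
      · exact ⟨(Set.mem_of_indicator_ne_zero hv).2, Set.indicator_le_self _ _ _⟩
      · rw [mul_left_comm, ← Real.rpow_add hu]
        simp
    · exact (lintegral_eq_zero_of_ae_eq_zero (Eventually.of_forall fun v =>
        Set.indicator_of_notMem (fun hz => hu hz.1) _)).trans_le zero_le
  · intro v
    by_cases hv : 0 < ρ v
    · refine lintegral_le_of_le_indicator (Real.rpow_nonneg hv.le (-ε)) (h₂ ρ hρ _ hv)
        (fun u hu => ?_) ?_
      · have hz : (u, v) ∈ S := Set.mem_of_indicator_ne_zero hu
        refine ⟨hz, (Set.indicator_le_self _ _ _).trans_eq ?_⟩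
        rw [mul_comm]
      · rw [mul_left_comm, ← Real.rpow_add hv]
        simp
    · exact (lintegral_eq_zero_of_ae_eq_zero (Eventually.of_forall fun v =>
        Set.indicator_of_notMem (fun hz => hv (hz.1.trans_le hz.2)) _)).trans_le zero_le
/-- A gauge `ρ` and a compatible quasi-distance `d` whose balls have measure at most `c * R ^ Q`. -/
structure IsHomogeneousGauge (μ : Measure X) (Q c : ℝ) (ρ : X → ℝ) (d : X → X → ℝ) : Prop where
  measurable : Measurable fun z : X × X => d z.1 z.2
  gauge_bound : HasBallBound μ Q c ρ
  ball_bound : ∀ u, HasBallBound μ Q c (d u)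
  symm : ∀ u v, d u v = d v u
  nonneg : ∀ u v, 0 ≤ d u v
  gauge_le : ∀ u v, ρ v ≤ 3 * max (ρ u) (d u v)
  dist_le : ∀ u v, d u v ≤ 3 * max (ρ u) (ρ v)

lemma exists_bound_half_hls {Q c p r lam : ℝ} (hQ : 0 < Q) (hc : 0 ≤ c)
    (hp : 1 < p) (hr : 1 < r) (hlam : lam = Q * (2 - 1 / p - 1 / r)) (hlamQ : lam < Q) :
    ∃ C : ℝ, 0 ≤ C ∧ ∀ D : X → ℝ, HasBallBound μ Q c D → (∀ x, 0 ≤ D x) →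
      ∀ ψ : X → ℝ≥0∞, Measurable ψ → ∫⁻ v, ψ v ∂μ ≤ 1 → ∀ m : ℝ, 0 < m →
      ∫⁻ v, {v | ψ v ≤ ENNReal.ofReal m}.indicator
        (fun v => ψ v ^ (1 / p) * ENNReal.ofReal (D v ^ (-lam))) v ∂μ ≤
        ENNReal.ofReal (C * m ^ (1 - 1 / r)) := by
  have hp0 : 0 < p := by linarith
  have ha : 0 < 1 - 1 / p := by rw [sub_pos, div_lt_one] <;> linarith
  have hb : 0 < 1 - 1 / r := by rw [sub_pos, div_lt_one] <;> linarith
  set a := 1 - 1 / p with ha_def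
  set b := 1 - 1 / r with hb_def
  have hlamab : lam = Q * (a + b) := by rw [hlam]; ring
  have hlam0 : 0 < lam := by rw [hlamab]; positivity
  have hlama : Q < lam * (1 / a) := by
    rw [mul_one_div, lt_div_iff₀ ha, hlamab]
    nlinarith
  have hconj : p.HolderConjugate (1 / a) := by
    rw [Real.holderConjugate_iff]
    refine ⟨hp, ?_⟩
    rw [one_div, inv_inv, ha_def]
    ring
  obtain ⟨C₁, hC₁, h₁⟩ := lintegral_rpow_inner_le (μ := μ) (Q := Q) (γ := lam) hc hlamQ
  obtain ⟨C₂, hC₂, h₂⟩ := lintegral_rpow_outer_le (μ := μ) (Q := Q) (γ := lam * (1 / a)) hc hlama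
  refine ⟨C₁ + C₂ ^ a, by positivity, fun D hD hD0 ψ hψ hψ1 m hm => ?_⟩
  set R := m ^ (-(1 / Q)) with hR_def
  have hR : 0 < R := by positivity
  set T₁ := {v | 0 < D v ∧ D v ≤ R}
  set T₂ := {v | R ≤ D v}
  have hT₁ : MeasurableSet T₁ := (measurableSet_lt measurable_const hD.measurable).inter
    (measurableSet_le hD.measurable measurable_const)
  have hT₂ : MeasurableSet T₂ := measurableSet_le measurable_const hD.measurable
  have hDm : Measurable fun v => ENNReal.ofReal (D v ^ (-lam)) :=
    (hD.measurable.pow_const _).ennreal_ofReal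
  have hpt : ∀ v, {v | ψ v ≤ ENNReal.ofReal m}.indicator
      (fun v => ψ v ^ (1 / p) * ENNReal.ofReal (D v ^ (-lam))) v ≤
      ENNReal.ofReal (m ^ (1 / p)) * T₁.indicator (fun v => ENNReal.ofReal (D v ^ (-lam))) v +
      ψ v ^ (1 / p) * T₂.indicator (fun v => ENNReal.ofReal (D v ^ (-lam))) v := by
    intro v
    refine Set.indicator_apply_le' (fun hv => ?_) fun _ => zero_le
    rcases (hD0 v).eq_or_lt with h0 | h0
    · simp [← h0, Real.zero_rpow (neg_ne_zero.2 hlam0.ne')]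
    rcases le_total (D v) R with h | h
    · refine le_add_right ?_
      rw [Set.indicator_of_mem (show v ∈ T₁ from ⟨h0, h⟩),
        ← ENNReal.ofReal_rpow_of_pos hm]
      gcongr
      exact hv
    · refine le_add_left ?_
      rw [Set.indicator_of_mem (show v ∈ T₂ from h)]
  have j1 : ∫⁻ v, ENNReal.ofReal (m ^ (1 / p)) *
      T₁.indicator (fun v => ENNReal.ofReal (D v ^ (-lam))) v ∂μ ≤
      ENNReal.ofReal (C₁ * m ^ b) := by
    rw [lintegral_const_mul' _ _ ENNReal.ofReal_ne_top]
    refine (mul_le_mul_right (h₁ D hD R hR) _).trans_eq ?_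
    rw [← ENNReal.ofReal_mul (by positivity), hR_def, ← Real.rpow_mul hm.le, mul_left_comm,
      ← Real.rpow_add hm]
    congr 3
    rw [hlamab, hb_def, ha_def]
    field_simp
    ring
  have j2 : ∫⁻ v, ψ v ^ (1 / p) *
      T₂.indicator (fun v => ENNReal.ofReal (D v ^ (-lam))) v ∂μ ≤
      ENNReal.ofReal (C₂ ^ a * m ^ b) := by
    have hold := ENNReal.lintegral_mul_le_Lp_mul_Lq μ hconj (hψ.pow_const (1 / p)).aemeasurable
      (hDm.indicator hT₂).aemeasurable
    simp only [Pi.mul_apply] at hold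
    refine hold.trans ?_
    have e1 : ∀ v, (ψ v ^ (1 / p)) ^ p = ψ v := fun v => by
      rw [← ENNReal.rpow_mul, one_div_mul_cancel hp0.ne', ENNReal.rpow_one]
    have e2 : ∀ v, T₂.indicator (fun v => ENNReal.ofReal (D v ^ (-lam))) v ^ (1 / a) =
        T₂.indicator (fun v => ENNReal.ofReal (D v ^ (-(lam * (1 / a))))) v := by
      intro v
      by_cases hv : v ∈ T₂
      · have hDv : 0 < D v := hR.trans_le hv
        rw [Set.indicator_of_mem hv, Set.indicator_of_mem hv,
          ENNReal.ofReal_rpow_of_pos (by positivity), ← Real.rpow_mul hDv.le, neg_mul]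
      · rw [Set.indicator_of_notMem hv, Set.indicator_of_notMem hv,
          ENNReal.zero_rpow_of_pos (by positivity)]
    simp only [e1, e2]
    rw [one_div_one_div]
    calc _ ≤ (1 : ℝ≥0∞) ^ (1 / p) *
          ENNReal.ofReal (C₂ * R ^ (Q - lam * (1 / a))) ^ a := by
          gcongr
          exact h₂ D hD R hR
      _ = ENNReal.ofReal (C₂ ^ a * m ^ b) := by
          rw [ENNReal.one_rpow, one_mul, ENNReal.ofReal_rpow_of_nonneg (by positivity) ha.le,
            Real.mul_rpow hC₂ (by positivity), hR_def, ← Real.rpow_mul hm.le,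
            ← Real.rpow_mul hm.le]
          congr 3
          rw [hlamab]
          field_simp
          ring
  refine (lintegral_mono hpt).trans ?_
  rw [lintegral_add_left ((hDm.indicator hT₁).const_mul _), add_mul,
    ENNReal.ofReal_add (by positivity) (by positivity)]
  exact add_le_add j1 j2

lemma exists_bound_hls_region [SFinite μ] {Q c p r lam : ℝ} {d : X → X → ℝ} (hQ : 0 < Q)
    (hc : 0 ≤ c) (hd : Measurable fun z : X × X => d z.1 z.2)
    (hball : ∀ u, HasBallBound μ Q c (d u)) (hd0 : ∀ u v, 0 ≤ d u v)
    (hp : 1 < p) (hr : 1 < r) (hlam : lam = Q * (2 - 1 / p - 1 / r)) (hlamQ : lam < Q) :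
    ∃ C : ℝ≥0∞, C ≠ ⊤ ∧ ∀ φ ψ : X → ℝ≥0∞, Measurable φ → Measurable ψ →
      ∫⁻ u, φ u ∂μ ≤ 1 → ∫⁻ v, ψ v ∂μ ≤ 1 →
      ∫⁻ z, {z : X × X | ψ z.2 ≤ φ z.1}.indicator (fun z => φ z.1 ^ (1 / r) * ψ z.2 ^ (1 / p) *
        ENNReal.ofReal (d z.1 z.2 ^ (-lam))) z ∂(μ.prod μ) ≤ C := by
  obtain ⟨C, hC, h⟩ := exists_bound_half_hls (μ := μ) hQ hc hp hr hlam hlamQ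
  have hb : 0 < 1 - 1 / r := by rw [sub_pos, div_lt_one] <;> linarith
  refine ⟨ENNReal.ofReal C, ENNReal.ofReal_ne_top, fun φ ψ hφ hψ hφ1 hψ1 => ?_⟩
  have hm : Measurable ({z : X × X | ψ z.2 ≤ φ z.1}.indicator
      (fun z => φ z.1 ^ (1 / r) * ψ z.2 ^ (1 / p) * ENNReal.ofReal (d z.1 z.2 ^ (-lam)))) :=
    ((((hφ.comp measurable_fst).pow_const _).mul ((hψ.comp measurable_snd).pow_const _)).mul
      (hd.pow_const _).ennreal_ofReal).indicator
      (measurableSet_le (hψ.comp measurable_snd) (hφ.comp measurable_fst))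
  rw [lintegral_prod _ hm.aemeasurable]
  have hfin : ∀ᵐ u ∂μ, φ u < ⊤ := ae_lt_top hφ (hφ1.trans_lt ENNReal.one_lt_top).ne
  calc _ ≤ ∫⁻ u, ENNReal.ofReal C * φ u ∂μ := by
        refine lintegral_mono_ae (hfin.mono fun u hu => ?_)
        rcases eq_or_ne (φ u) 0 with h0 | h0
        · refine (lintegral_eq_zero_of_ae_eq_zero (Eventually.of_forall fun v => ?_)).trans_le
            zero_le
          refine Set.indicator_apply_eq_zero.2 fun _ => ?_
          simp [h0, ENNReal.zero_rpow_of_pos (show 0 < r⁻¹ by positivity)]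
        · set m := (φ u).toReal with hm_def
          have hm0 : 0 < m := ENNReal.toReal_pos h0 hu.ne
          have hmu : φ u = ENNReal.ofReal m := (ENNReal.ofReal_toReal hu.ne).symm
          have key := h (d u) (hball u) (hd0 u) ψ hψ hψ1 m hm0
          calc _ = ∫⁻ v, φ u ^ (1 / r) * {v | ψ v ≤ ENNReal.ofReal m}.indicator
                (fun v => ψ v ^ (1 / p) * ENNReal.ofReal (d u v ^ (-lam))) v ∂μ := by
                refine lintegral_congr fun v => ?_
                by_cases hv : ψ v ≤ φ u
                · rw [Set.indicator_of_mem (by exact hv),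
                    Set.indicator_of_mem (by rwa [← hmu]), mul_assoc]
                · rw [Set.indicator_of_notMem (by exact hv),
                    Set.indicator_of_notMem (by rwa [← hmu]), mul_zero]
            _ = φ u ^ (1 / r) * _ := lintegral_const_mul' _ _
                (ENNReal.rpow_ne_top_of_nonneg (by positivity) hu.ne)
            _ ≤ φ u ^ (1 / r) * ENNReal.ofReal (C * m ^ (1 - 1 / r)) := by gcongr
            _ = ENNReal.ofReal C * φ u := by
                rw [ENNReal.ofReal_mul hC, ← ENNReal.ofReal_rpow_of_pos hm0, ← hmu,
                  mul_left_comm, ← ENNReal.rpow_add_of_nonneg _ _ (by positivity) hb.le]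
                simp
    _ = ENNReal.ofReal C * ∫⁻ u, φ u ∂μ := lintegral_const_mul' _ _ ENNReal.ofReal_ne_top
    _ ≤ ENNReal.ofReal C := mul_le_of_le_one_right' hφ1

/-- The Hardy–Littlewood–Sobolev inequality. -/
lemma kernelBounded_hls [SFinite μ] {Q c p r lam : ℝ} {ρ : X → ℝ} {d : X → X → ℝ} (hQ : 0 < Q)
    (hc : 0 ≤ c) (hd : IsHomogeneousGauge μ Q c ρ d) (hp : 1 < p) (hr : 1 < r)
    (hlam : lam = Q * (2 - 1 / p - 1 / r)) (hlamQ : lam < Q) :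
    KernelBounded μ r p fun z => ENNReal.ofReal (d z.1 z.2 ^ (-lam)) := by
  obtain ⟨C, hC, h⟩ := exists_bound_hls_region hQ hc hd.measurable hd.ball_bound hd.nonneg
    hp hr hlam hlamQ
  obtain ⟨C', hC', h'⟩ := exists_bound_hls_region hQ hc hd.measurable hd.ball_bound hd.nonneg
    hr hp (lam := lam) (by rw [hlam]; ring) hlamQ
  refine ⟨C + C', by finiteness, fun F G hF hG hA hB => ?_⟩
  have hr0 : 0 < r := by linarith
  have hp0 : 0 < p := by linarith
  set A := ∫⁻ u, F u ^ r ∂μ with hA_def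
  set B := ∫⁻ v, G v ^ p ∂μ with hB_def
  have hF1 : Measurable fun z : X × X => F z.1 := hF.comp measurable_fst
  have hG2 : Measurable fun z : X × X => G z.2 := hG.comp measurable_snd
  have hdm : Measurable fun z : X × X => ENNReal.ofReal (d z.1 z.2 ^ (-lam)) :=
    (hd.measurable.pow_const _).ennreal_ofReal
  have hm : Measurable fun z : X × X => F z.1 * G z.2 * ENNReal.ofReal (d z.1 z.2 ^ (-lam)) :=
    (hF1.mul hG2).mul hdm
  rcases eq_or_ne A 0 with hA0 | hA0
  · have hF0 : ∀ᵐ u ∂μ, F u = 0 := by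
      have := (lintegral_eq_zero_iff (hF.pow_const r)).1 hA0
      exact this.mono fun u hu => (ENNReal.rpow_eq_zero_iff_of_pos hr0).1 hu
    rw [lintegral_prod _ hm.aemeasurable]
    refine (lintegral_eq_zero_of_ae_eq_zero (hF0.mono fun u hu => ?_)).trans_le zero_le
    simp [hu]
  rcases eq_or_ne B 0 with hB0 | hB0
  · have hG0 : ∀ᵐ u ∂μ, G u = 0 := by
      have := (lintegral_eq_zero_iff (hG.pow_const p)).1 hB0
      exact this.mono fun u hu => (ENNReal.rpow_eq_zero_iff_of_pos hp0).1 hu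
    rw [lintegral_prod_symm _ hm.aemeasurable]
    refine (lintegral_eq_zero_of_ae_eq_zero (hG0.mono fun u hu => ?_)).trans_le zero_le
    simp [hu]
  set φ : X → ℝ≥0∞ := fun u => A⁻¹ * F u ^ r with hφ_def
  set ψ : X → ℝ≥0∞ := fun v => B⁻¹ * G v ^ p with hψ_def
  have hφ : Measurable φ := (hF.pow_const r).const_mul _
  have hψ : Measurable ψ := (hG.pow_const p).const_mul _
  have hφ1 : ∫⁻ u, φ u ∂μ ≤ 1 := by
    rw [lintegral_const_mul _ (hF.pow_const r)]
    exact (ENNReal.inv_mul_cancel hA0 hA).le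
  have hψ1 : ∫⁻ u, ψ u ∂μ ≤ 1 := by
    rw [lintegral_const_mul _ (hG.pow_const p)]
    exact (ENNReal.inv_mul_cancel hB0 hB).le
  have root : ∀ (x A : ℝ≥0∞) (s : ℝ), A ≠ 0 → A ≠ ⊤ → 0 < s →
      x = A ^ (1 / s) * (A⁻¹ * x ^ s) ^ (1 / s) := by
    intro x A s hA0 hA hs
    rw [← ENNReal.mul_rpow_of_nonneg _ _ (by positivity), ← mul_assoc,
      ENNReal.mul_inv_cancel hA0 hA, one_mul, ← ENNReal.rpow_mul, mul_one_div_cancel hs.ne',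
      ENNReal.rpow_one]
  set H : X × X → ℝ≥0∞ := fun z => φ z.1 ^ (1 / r) * ψ z.2 ^ (1 / p) *
    ENNReal.ofReal (d z.1 z.2 ^ (-lam)) with hH
  have hHm : Measurable H :=
    (((hφ.comp measurable_fst).pow_const _).mul ((hψ.comp measurable_snd).pow_const _)).mul hdm
  have g2 : ∫⁻ z, {z : X × X | φ z.1 ≤ ψ z.2}.indicator H z ∂(μ.prod μ) ≤ C' := by
    have := h' ψ φ hψ hφ hψ1 hφ1
    rw [← lintegral_prod_swap] at this
    refine (lintegral_congr fun z => ?_).trans_le this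
    by_cases hz : φ z.1 ≤ ψ z.2
    · rw [Set.indicator_of_mem (by exact hz), Set.indicator_of_mem (by exact hz)]
      simp only [hH, Prod.fst_swap, Prod.snd_swap]
      rw [hd.symm z.2 z.1, mul_comm (ψ z.2 ^ _)]
    · rw [Set.indicator_of_notMem (by exact hz), Set.indicator_of_notMem (by exact hz)]
  have hHint : ∫⁻ z, H z ∂(μ.prod μ) ≤ C + C' := by
    calc ∫⁻ z, H z ∂(μ.prod μ)
        ≤ ∫⁻ z, {z : X × X | ψ z.2 ≤ φ z.1}.indicator H z +
            {z : X × X | φ z.1 ≤ ψ z.2}.indicator H z ∂(μ.prod μ) := by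
          refine lintegral_mono fun z => ?_
          dsimp only
          rcases le_total (ψ z.2) (φ z.1) with hz | hz
          · exact le_add_right (Set.indicator_of_mem (by exact hz) _).ge
          · exact le_add_left (Set.indicator_of_mem (by exact hz) _).ge
      _ = _ := lintegral_add_left (hHm.indicator (measurableSet_le (hψ.comp measurable_snd)
            (hφ.comp measurable_fst))) _
      _ ≤ C + C' := add_le_add (h φ ψ hφ hψ hφ1 hψ1) g2
  calc ∫⁻ z, F z.1 * G z.2 * ENNReal.ofReal (d z.1 z.2 ^ (-lam)) ∂(μ.prod μ)
      = ∫⁻ z, A ^ (1 / r) * B ^ (1 / p) * H z ∂(μ.prod μ) := by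
        refine lintegral_congr fun z => ?_
        rw [root (F z.1) A r hA0 hA hr0, root (G z.2) B p hB0 hB hp0]
        simp only [hH, hφ_def, hψ_def]
        ring
    _ = A ^ (1 / r) * B ^ (1 / p) * ∫⁻ z, H z ∂(μ.prod μ) := lintegral_const_mul _ hHm
    _ ≤ A ^ (1 / r) * B ^ (1 / p) * (C + C') := by gcongr
    _ = _ := by ring
/-- The pairs of points whose gauges are comparable and dominate their distance. -/
def comparableSet (ρ : X → ℝ) (d : X → X → ℝ) : Set (X × X) :=
  {z | 0 < d z.1 z.2 ∧ 0 < ρ z.1 ∧ 0 < ρ z.2 ∧ d z.1 z.2 ≤ 9 * ρ z.1 ∧ d z.1 z.2 ≤ 9 * ρ z.2 ∧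
    ρ z.2 ≤ 3 * ρ z.1}

lemma measurableSet_comparableSet {Q c : ℝ} {ρ : X → ℝ} {d : X → X → ℝ}
    (hd : IsHomogeneousGauge μ Q c ρ d) : MeasurableSet (comparableSet ρ d) := by
  have h1 : Measurable fun z : X × X => ρ z.1 := hd.gauge_bound.measurable.comp measurable_fst
  have h2 : Measurable fun z : X × X => ρ z.2 := hd.gauge_bound.measurable.comp measurable_snd
  exact (measurableSet_lt measurable_const hd.measurable).inter
    ((measurableSet_lt measurable_const h1).inter ((measurableSet_lt measurable_const h2).inter
    ((measurableSet_le hd.measurable (h1.const_mul 9)).inter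
    ((measurableSet_le hd.measurable (h2.const_mul 9)).inter
    (measurableSet_le h2 (h1.const_mul 3))))))

lemma kernelBounded_comparable_of_pos [SFinite μ] {Q c p r lam τ : ℝ} {ρ : X → ℝ}
    {d : X → X → ℝ} (hc : 0 ≤ c) (hd : IsHomogeneousGauge μ Q c ρ d)
    (hp : 1 < p) (hr : 1 < r) (hpr : 1 ≤ 1 / p + 1 / r) (hτ : 0 < τ)
    (hlam : lam + τ = Q * (2 - 1 / p - 1 / r)) :
    KernelBounded μ r p ((comparableSet ρ d).indicator
      fun z => ENNReal.ofReal (ρ z.1 ^ (-τ) * d z.1 z.2 ^ (-lam))) := by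
  have ha : 0 < 1 - 1 / p := by rw [sub_pos, div_lt_one] <;> linarith
  have hb : 0 < 1 - 1 / r := by rw [sub_pos, div_lt_one] <;> linarith
  set a := 1 - 1 / p with ha_def
  set b := 1 - 1 / r with hb_def
  have hab : 0 < a + b := add_pos ha hb
  obtain ⟨s, hs, hsab⟩ : ∃ s : ℝ, 0 < s ∧ s * (a + b) = 1 :=
    ⟨1 / (a + b), by positivity, one_div_mul_cancel hab.ne'⟩
  have hls : (lam + τ) * s = Q := by
    rw [hlam]
    linear_combination Q * hsab
  have hlsQ : lam * s < Q := by nlinarith [mul_pos hτ hs]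
  set S := comparableSet ρ d with hS
  have hSm : MeasurableSet S := measurableSet_comparableSet hd
  have hm1 : Measurable fun z : X × X => ρ z.1 := hd.gauge_bound.measurable.comp measurable_fst
  obtain ⟨C, hC, h⟩ := lintegral_rpow_inner_le (μ := μ) (Q := Q) (γ := lam * s) hc hlsQ
  set k : X × X → ℝ≥0∞ := S.indicator
    fun z => ENNReal.ofReal (ρ z.1 ^ (-(τ * s)) * d z.1 z.2 ^ (-(lam * s))) with hk
  have hkm : Measurable k :=
    ((hm1.pow_const _).mul (hd.measurable.pow_const _)).ennreal_ofReal.indicator hSm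
  have scale : ∀ x : ℝ, 0 < x →
      x ^ (-(τ * s)) * (C * (9 * x) ^ (Q - lam * s)) = C * 9 ^ (τ * s) := by
    intro x hx
    have e : Q - lam * s = τ * s := by linear_combination -hls
    rw [e, Real.mul_rpow (by norm_num) hx.le, Real.rpow_neg hx.le]
    have : x ^ (τ * s) ≠ 0 := by positivity
    field_simp
  refine ⟨ENNReal.ofReal (C * 9 ^ (τ * s)) ^ a *
    ENNReal.ofReal (3 ^ (τ * s) * (C * 9 ^ (τ * s))) ^ b, by finiteness, fun F G hF hG _ _ => ?_⟩
  refine lintegral_mul_kernel_le_of_schur (c := 1 / p + 1 / r - 1) (k₁ := k) (k₂ := k)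
    (by linarith) (by linarith) ha.le hb.le (by linarith) (by linarith) (by linarith)
    (by linarith) hF hG hkm hkm ?_ ?_ ?_
  · intro z
    rw [← ENNReal.rpow_add_of_nonneg _ _ ha.le hb.le]
    by_cases hz : z ∈ S
    · have hx : 0 < ρ z.1 := hz.2.1
      have hy : 0 < d z.1 z.2 := hz.1
      simp only [hk, Set.indicator_of_mem hz]
      rw [ENNReal.ofReal_rpow_of_pos (by positivity)]
      refine ENNReal.ofReal_le_ofReal (le_of_eq ?_)
      rw [Real.mul_rpow (by positivity) (by positivity), ← Real.rpow_mul hx.le,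
        ← Real.rpow_mul hy.le]
      congr 2
      · linear_combination τ * hsab
      · linear_combination lam * hsab
    · simp [Set.indicator_of_notMem hz]
  · intro u
    by_cases hu : 0 < ρ u
    · refine lintegral_le_of_le_indicator (Real.rpow_nonneg hu.le (-(τ * s)))
        (h (d u) (hd.ball_bound u) (9 * ρ u) (by positivity)) (fun v hv => ?_) (scale _ hu)
      have hz : (u, v) ∈ S := Set.mem_of_indicator_ne_zero hv
      exact ⟨⟨hz.1, hz.2.2.2.1⟩, Set.indicator_le_self _ _ _⟩
    · exact (lintegral_eq_zero_of_ae_eq_zero (Eventually.of_forall fun v =>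
        Set.indicator_of_notMem (fun hz => hu hz.2.1) _)).trans_le zero_le
  · intro v
    by_cases hv : 0 < ρ v
    · refine lintegral_le_of_le_indicator (D := 3 ^ (τ * s) * ρ v ^ (-(τ * s))) (by positivity)
        (h (d v) (hd.ball_bound v) (9 * ρ v) (by positivity)) (fun u hu => ?_)
        (by rw [mul_assoc, scale _ hv])
      have hz : (u, v) ∈ S := Set.mem_of_indicator_ne_zero hu
      refine ⟨⟨by rw [hd.symm]; exact hz.1, by rw [hd.symm]; exact hz.2.2.2.2.1⟩,
        (Set.indicator_le_self _ _ _).trans (ENNReal.ofReal_le_ofReal ?_)⟩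
      dsimp only
      rw [hd.symm u v]
      have hle : ρ v / 3 ≤ ρ u := by
        have := hz.2.2.2.2.2
        dsimp only at this
        linarith
      have h3 : ρ u ^ (-(τ * s)) ≤ 3 ^ (τ * s) * ρ v ^ (-(τ * s)) := by
        refine (Real.rpow_le_rpow_of_nonpos (by positivity) hle
          (by nlinarith [mul_pos hτ hs])).trans_eq ?_
        rw [Real.div_rpow hv.le (by norm_num), Real.rpow_neg (by norm_num : (0 : ℝ) ≤ 3),
          div_inv_eq_mul, mul_comm]
      have := hd.nonneg v u
      gcongr
    · exact (lintegral_eq_zero_of_ae_eq_zero (Eventually.of_forall fun u =>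
        Set.indicator_of_notMem (fun hz => hv hz.2.2.1) _)).trans_le zero_le

lemma kernelBounded_comparable [SFinite μ] {Q c p r lam τ : ℝ} {ρ : X → ℝ}
    {d : X → X → ℝ} (hQ : 0 < Q) (hc : 0 ≤ c) (hd : IsHomogeneousGauge μ Q c ρ d)
    (hp : 1 < p) (hr : 1 < r) (hpr : 1 ≤ 1 / p + 1 / r) (hτ : 0 ≤ τ) (hlamQ : lam < Q)
    (hlam : lam + τ = Q * (2 - 1 / p - 1 / r)) :
    KernelBounded μ r p ((comparableSet ρ d).indicator
      fun z => ENNReal.ofReal (ρ z.1 ^ (-τ) * d z.1 z.2 ^ (-lam))) := by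
  rcases hτ.eq_or_lt with rfl | hτ
  · refine (kernelBounded_hls hQ hc hd hp hr (by linarith) hlamQ).mono_mul (D := 1) fun z => ?_
    simpa using Set.indicator_le_self _ _ _
  · exact kernelBounded_comparable_of_pos hc hd hp hr hpr hτ hlam

/-- The Stein–Weiss inequality for a homogeneous gauge. -/
lemma kernelBounded_stein_weiss [SFinite μ] {Q c p r lam α β : ℝ} {ρ : X → ℝ}
    {d : X → X → ℝ} (hQ : 0 < Q) (hc : 0 ≤ c) (hd : IsHomogeneousGauge μ Q c ρ d)
    (hp : 1 < p) (hr : 1 < r) (hpr : 1 ≤ 1 / p + 1 / r) (hlamQ : lam < Q)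
    (hαβ : 0 ≤ α + β) (hα : α < Q * (1 - 1 / r)) (hβ : β < Q * (1 - 1 / p))
    (hlam : lam + (α + β) = Q * (2 - 1 / p - 1 / r)) :
    KernelBounded μ r p ({z : X × X | 0 < ρ z.1 ∧ 0 < ρ z.2 ∧ 0 < d z.1 z.2}.indicator
      fun z => ENNReal.ofReal (ρ z.1 ^ (-α) * d z.1 z.2 ^ (-lam) * ρ z.2 ^ (-β))) := by
  have hA := kernelBounded_hardy hc hd.gauge_bound hp hr hpr hα hlam
  have hB := (kernelBounded_hardy (σ := lam + (α + β)) hc hd.gauge_bound hr hp (by linarith) hβ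
    (by linarith)).swap
  have hE := kernelBounded_comparable hQ hc hd hp hr hpr hαβ hlamQ hlam
  have hm1 : Measurable fun z : X × X => ρ z.1 := hd.gauge_bound.measurable.comp measurable_fst
  have hm2 : Measurable fun z : X × X => ρ z.2 := hd.gauge_bound.measurable.comp measurable_snd
  have hmeas : ∀ e e' : ℝ, Measurable ({z : X × X | 0 < ρ z.1 ∧ ρ z.1 ≤ ρ z.2}.indicator
      fun z => ENNReal.ofReal (ρ z.1 ^ e * ρ z.2 ^ e')) := fun e e' =>
    ((hm1.pow_const _).mul (hm2.pow_const _)).ennreal_ofReal.indicator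
      ((measurableSet_lt measurable_const hm1).inter (measurableSet_le hm1 hm2))
  refine ((hA.add hB (hmeas _ _)).add hE
    ((hmeas _ _).add ((hmeas _ _).comp measurable_swap))).mono_mul
    (D := 3 ^ lam + 9 ^ |β| * 3 ^ β) fun z => ?_
  refine Set.indicator_apply_le' (fun hz => ?_) fun _ => zero_le
  obtain ⟨hx, hy, hδ⟩ := hz
  set x := ρ z.1 with hx_def
  set y := ρ z.2 with hy_def
  set δ := d z.1 z.2 with hδ_def
  set D : ℝ := 3 ^ lam + 9 ^ |β| * 3 ^ β with hD
  have third : ∀ t : ℝ, 0 < t → t / 3 ≤ δ → δ ^ (-lam) ≤ 3 ^ lam * t ^ (-lam) := by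
    intro t ht h
    refine (Real.rpow_le_rpow_of_nonpos (by positivity) h (by linarith)).trans_eq ?_
    rw [Real.div_rpow ht.le (by norm_num), Real.rpow_neg (by norm_num : (0 : ℝ) ≤ 3),
      div_inv_eq_mul, mul_comm]
  have hD1 : (3 : ℝ) ^ lam ≤ D := by rw [hD]; linarith [show (0 : ℝ) < 9 ^ |β| * 3 ^ β by positivity]
  have hD2 : (9 : ℝ) ^ |β| * 3 ^ β ≤ D := by rw [hD]; linarith [show (0 : ℝ) < 3 ^ lam by positivity]
  have hD0 : 0 ≤ D := by positivity
  rcases lt_or_ge (3 * x) y with hxy | hxy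
  · have hδy : y / 3 ≤ δ := by
      have := hd.gauge_le z.1 z.2
      rcases max_cases (ρ z.1) (d z.1 z.2) with h | h <;> rw [h.1] at this <;> linarith
    have hz : z ∈ {z : X × X | 0 < ρ z.1 ∧ ρ z.1 ≤ ρ z.2} := ⟨hx, by linarith⟩
    refine le_trans ?_ (mul_le_mul_right (le_add_right (le_add_right le_rfl)) _)
    rw [Set.indicator_of_mem hz, ← ENNReal.ofReal_mul hD0]
    refine ENNReal.ofReal_le_ofReal ?_
    calc x ^ (-α) * δ ^ (-lam) * y ^ (-β)
        ≤ x ^ (-α) * (D * y ^ (-lam)) * y ^ (-β) := by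
          gcongr
          exact (third y hy hδy).trans (by gcongr)
      _ = D * (x ^ (-α) * (y ^ (-lam) * y ^ (-β))) := by ring
      _ = D * (x ^ (-α) * y ^ (α - (lam + (α + β)))) := by
          rw [← Real.rpow_add hy]
          congr 3
          ring
  rcases lt_or_ge (3 * y) x with hyx | hyx
  · have hδx : x / 3 ≤ δ := by
      have := hd.gauge_le z.2 z.1
      rw [hd.symm z.2 z.1] at this
      rcases max_cases (ρ z.2) (d z.1 z.2) with h | h <;> rw [h.1] at this <;> linarith
    have hz : z.swap ∈ {z : X × X | 0 < ρ z.1 ∧ ρ z.1 ≤ ρ z.2} := ⟨hy, by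
      simp only [Prod.fst_swap, Prod.snd_swap]; linarith⟩
    refine le_trans ?_ (mul_le_mul_right (le_add_right (le_add_left le_rfl)) _)
    rw [Set.indicator_of_mem hz, ← ENNReal.ofReal_mul hD0]
    refine ENNReal.ofReal_le_ofReal ?_
    simp only [Prod.fst_swap, Prod.snd_swap]
    calc x ^ (-α) * δ ^ (-lam) * y ^ (-β)
        ≤ x ^ (-α) * (D * x ^ (-lam)) * y ^ (-β) := by
          gcongr
          exact (third x hx hδx).trans (by gcongr)
      _ = D * (y ^ (-β) * (x ^ (-lam) * x ^ (-α))) := by ring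
      _ = D * (y ^ (-β) * x ^ (β - (lam + (α + β)))) := by
          rw [← Real.rpow_add hx]
          congr 3
          ring
  · have hδ3 := hd.dist_le z.1 z.2
    have hδ9 : δ ≤ 9 * x ∧ δ ≤ 9 * y := by
      rcases max_cases (ρ z.1) (ρ z.2) with h | h <;> rw [h.1] at hδ3 <;>
        constructor <;> linarith
    have hz : z ∈ comparableSet ρ d := ⟨hδ, hx, hy, hδ9.1, hδ9.2, hxy⟩
    refine le_trans ?_ (mul_le_mul_right (le_add_left le_rfl) _)
    rw [Set.indicator_of_mem hz, ← ENNReal.ofReal_mul hD0]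
    refine ENNReal.ofReal_le_ofReal ?_
    have hyβ : y ^ (-β) ≤ D * x ^ (-β) := by
      refine (rpow_neg_le_of_mem_annulus (t := x / 3) (M := 9) β (by positivity) (by linarith)
        (by linarith)).trans ?_
      rw [Real.div_rpow hx.le (by norm_num), Real.rpow_neg (by norm_num : (0 : ℝ) ≤ 3),
        div_inv_eq_mul, mul_comm (x ^ (-β)), ← mul_assoc]
      gcongr
    calc x ^ (-α) * δ ^ (-lam) * y ^ (-β)
        ≤ x ^ (-α) * δ ^ (-lam) * (D * x ^ (-β)) := by gcongr
      _ = D * ((x ^ (-α) * x ^ (-β)) * δ ^ (-lam)) := by ring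
      _ = D * (x ^ (-(α + β)) * δ ^ (-lam)) := by
          rw [← Real.rpow_add hx]
          congr 3
          ring

end Abstract
lemma HasBallBound.ae_pos {X : Type*} [MeasurableSpace X] {μ : Measure X} {Q c : ℝ} {ρ : X → ℝ}
    (h : HasBallBound μ Q c ρ) (hQ : 0 < Q) : ∀ᵐ x ∂μ, 0 < ρ x := by
  have hlim : Tendsto (fun R : ℝ => ENNReal.ofReal (c * R ^ Q)) (nhdsWithin 0 (Set.Ioi 0))
      (nhds 0) := by
    have h1 : Tendsto (fun R : ℝ => ENNReal.ofReal (c * R ^ Q)) (nhds 0)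
        (nhds (ENNReal.ofReal (c * 0 ^ Q))) :=
      ENNReal.tendsto_ofReal (((Real.continuousAt_rpow_const 0 Q (Or.inr hQ.le)).tendsto).const_mul c)
    rw [Real.zero_rpow hQ.ne', mul_zero, ENNReal.ofReal_zero] at h1
    exact h1.mono_left nhdsWithin_le_nhds
  refine le_antisymm (ge_of_tendsto hlim ?_) zero_le
  filter_upwards [self_mem_nhdsWithin] with R hR
  refine (measure_mono fun x hx => ?_).trans (h.measure_lt_le R hR)
  have hx' : ¬ 0 < ρ x := hx
  exact (not_lt.1 hx').trans_lt hR

section Heisenberg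

variable {n : ℕ}

lemma znorm_eq_norm (z : Fin n → ℂ) : znorm z = ‖(WithLp.toLp 2 z : EuclideanSpace ℂ (Fin n))‖ := by
  simp [znorm, EuclideanSpace.norm_eq, Complex.normSq_eq_norm_sq]

lemma znorm_nonneg (z : Fin n → ℂ) : 0 ≤ znorm z := Real.sqrt_nonneg _

lemma znorm_add_le (z w : Fin n → ℂ) : znorm (z + w) ≤ znorm z + znorm w := by
  simp only [znorm_eq_norm, WithLp.toLp_add]
  exact norm_add_le _ _

lemma znorm_neg (z : Fin n → ℂ) : znorm (-z) = znorm z := by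
  simp [znorm]

lemma norm_apply_le_znorm (z : Fin n → ℂ) (j : Fin n) : ‖z j‖ ≤ znorm z := by
  rw [znorm_eq_norm]
  exact PiLp.norm_apply_le (WithLp.toLp 2 z : EuclideanSpace ℂ (Fin n)) j

lemma abs_im_sum_mul_conj_le (z w : Fin n → ℂ) :
    |(∑ j, z j * (starRingEnd ℂ) (w j)).im| ≤ znorm z * znorm w := by
  have h := norm_inner_le_norm (𝕜 := ℂ) (WithLp.toLp 2 w : EuclideanSpace ℂ (Fin n))
    (WithLp.toLp 2 z)
  rw [PiLp.inner_apply] at h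
  simp only [RCLike.inner_apply] at h
  rw [znorm_eq_norm, znorm_eq_norm, mul_comm]
  exact (Complex.abs_im_le_norm _).trans h

lemma Hnorm_nonneg (u : Hn n) : 0 ≤ Hnorm u := by
  unfold Hnorm
  positivity

lemma Hnorm_pow_four (u : Hn n) : Hnorm u ^ 4 = znorm u.1 ^ 4 + u.2 ^ 2 := by
  unfold Hnorm
  rw [← Real.rpow_natCast, ← Real.rpow_mul (by positivity)]
  norm_num

lemma znorm_le_Hnorm (u : Hn n) : znorm u.1 ≤ Hnorm u := by
  refine le_of_pow_le_pow_left₀ (n := 4) (by norm_num) (Hnorm_nonneg u) ?_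
  rw [Hnorm_pow_four]
  linarith [sq_nonneg u.2]

lemma abs_snd_le_Hnorm_sq (u : Hn n) : |u.2| ≤ Hnorm u ^ 2 := by
  refine abs_le_of_sq_le_sq ?_ (by positivity)
  rw [← pow_mul, Hnorm_pow_four]
  linarith [pow_nonneg (znorm_nonneg u.1) 4]

lemma Hnorm_Hmul_le (u v : Hn n) : Hnorm (Hmul u v) ≤ 3 * max (Hnorm u) (Hnorm v) := by
  set m := max (Hnorm u) (Hnorm v)
  have hu : Hnorm u ≤ m := le_max_left _ _
  have hv : Hnorm v ≤ m := le_max_right _ _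
  have hm : 0 ≤ m := (Hnorm_nonneg u).trans hu
  have zu := (znorm_le_Hnorm u).trans hu
  have zv := (znorm_le_Hnorm v).trans hv
  have tu := (abs_snd_le_Hnorm_sq u).trans (pow_le_pow_left₀ (Hnorm_nonneg u) hu 2)
  have tv := (abs_snd_le_Hnorm_sq v).trans (pow_le_pow_left₀ (Hnorm_nonneg v) hv 2)
  have hz : znorm (Hmul u v).1 ≤ 2 * m := (znorm_add_le u.1 v.1).trans (by linarith)
  have him : |(∑ j, u.1 j * (starRingEnd ℂ) (v.1 j)).im| ≤ m ^ 2 := by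
    refine (abs_im_sum_mul_conj_le u.1 v.1).trans ?_
    rw [sq]
    exact mul_le_mul zu zv (znorm_nonneg _) hm
  have ht : |(Hmul u v).2| ≤ 4 * m ^ 2 := by
    change |u.2 + v.2 + 2 * (∑ j, u.1 j * (starRingEnd ℂ) (v.1 j)).im| ≤ 4 * m ^ 2
    rw [abs_le] at *
    constructor <;> linarith
  refine le_of_pow_le_pow_left₀ (n := 4) (by norm_num) (by positivity) ?_
  rw [Hnorm_pow_four]
  have h1 := pow_le_pow_left₀ (znorm_nonneg _) hz 4
  have h2 := pow_le_pow_left₀ (abs_nonneg _) ht 2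
  rw [sq_abs] at h2
  nlinarith [pow_nonneg hm 4]

lemma Hmul_Hmul_Hinv (u v : Hn n) : Hmul u (Hmul (Hinv u) v) = v := by
  refine Prod.ext ?_ ?_
  · simp [Hmul, Hinv]
  · simp only [Hmul, Hinv, Pi.add_apply, Pi.neg_apply, map_add, map_neg, mul_add, neg_mul,
      Finset.sum_add_distrib, Finset.sum_neg_distrib, Complex.add_im, Complex.neg_im, mul_neg,
      Complex.mul_conj, ← Complex.ofReal_sum, Complex.ofReal_im]
    ring

lemma Hinv_Hmul_Hinv (u v : Hn n) : Hinv (Hmul (Hinv u) v) = Hmul (Hinv v) u := by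
  refine Prod.ext ?_ ?_
  · simp [Hmul, Hinv, add_comm]
  · have : (∑ j, v.1 j * (starRingEnd ℂ) (u.1 j)).im =
        -(∑ j, u.1 j * (starRingEnd ℂ) (v.1 j)).im := by
      rw [← Complex.conj_im, map_sum]
      simp [mul_comm]
    simp only [Hmul, Hinv, Pi.neg_apply, neg_mul, Finset.sum_neg_distrib, Complex.neg_im, this]
    ring

lemma Hnorm_Hinv (u : Hn n) : Hnorm (Hinv u) = Hnorm u := by
  simp [Hnorm, Hinv, znorm_neg]

lemma Hdist_comm (u v : Hn n) : Hdist u v = Hdist v u := by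
  rw [Hdist, Hdist, ← Hinv_Hmul_Hinv, Hnorm_Hinv]

lemma Hdist_zero_left (v : Hn n) : Hdist 0 v = Hnorm v := by
  simp [Hdist, Hmul, Hinv]

lemma Hnorm_le (u v : Hn n) : Hnorm v ≤ 3 * max (Hnorm u) (Hdist u v) := by
  conv_lhs => rw [← Hmul_Hmul_Hinv u v]
  exact Hnorm_Hmul_le _ _

lemma Hdist_le (u v : Hn n) : Hdist u v ≤ 3 * max (Hnorm u) (Hnorm v) := by
  rw [← Hnorm_Hinv u]
  exact Hnorm_Hmul_le _ _

lemma continuous_Hdist : Continuous fun z : Hn n × Hn n => Hdist z.1 z.2 := by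
  have h : Continuous fun z : Hn n × Hn n => Hmul (Hinv z.1) z.2 := by
    unfold Hmul Hinv
    fun_prop
  have h' : Continuous (Hnorm : Hn n → ℝ) := by
    unfold Hnorm znorm
    have : Continuous fun u : Hn n => √(∑ j, Complex.normSq (u.1 j)) ^ 4 + u.2 ^ 2 := by
      have := Complex.continuous_normSq
      fun_prop
    exact this.rpow_const fun _ => Or.inr (by norm_num)
  exact h'.comp h

lemma hasBallBound_Hdist (u : Hn n) :
    HasBallBound volume (2 * n + 2 : ℝ) (2 * Real.pi ^ n) (Hdist u) := by
  refine ⟨(continuous_Hdist.comp (Continuous.prodMk_right u)).measurable, fun R hR => ?_⟩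
  set g : (Fin n → ℂ) → ℝ := fun z =>
    u.2 - 2 * (∑ j, (-u.1) j * (starRingEnd ℂ) (z j)).im with hg
  have hgc : Continuous g := by
    rw [hg]
    fun_prop
  set E : Set (Hn n) := {v | v.1 ∈ Metric.ball u.1 R ∧ |v.2 - g v.1| < R ^ 2} with hE
  have hEm : MeasurableSet E := by
    refine (measurableSet_ball.preimage measurable_fst).inter ?_
    exact measurableSet_lt
      (measurable_snd.sub (hgc.measurable.comp measurable_fst)).abs measurable_const
  have hsub : {v | Hdist u v < R} ⊆ E := by
    intro v hv
    have hv' : Hnorm (Hmul (Hinv u) v) < R := hv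
    constructor
    · rw [Metric.mem_ball, dist_pi_lt_iff hR]
      intro j
      have := (norm_apply_le_znorm _ j).trans_lt ((znorm_le_Hnorm _).trans_lt hv')
      have e : v.1 j - u.1 j = (Hmul (Hinv u) v).1 j := by
        simp [Hmul, Hinv, sub_eq_neg_add]
      rw [dist_eq_norm, e]
      exact this
    · have := (abs_snd_le_Hnorm_sq _).trans_lt
        (pow_lt_pow_left₀ hv' (Hnorm_nonneg _) two_ne_zero)
      have e : v.2 - g v.1 = (Hmul (Hinv u) v).2 := by
        simp only [hg, Hmul, Hinv]
        ring
      change |v.2 - g v.1| < R ^ 2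
      rw [e]
      exact this
  refine (measure_mono hsub).trans ?_
  rw [Measure.volume_eq_prod, Measure.prod_apply hEm]
  calc ∫⁻ z, volume (Prod.mk z ⁻¹' E)
      ≤ ∫⁻ z, (Metric.ball u.1 R).indicator (fun _ => ENNReal.ofReal (2 * R ^ 2)) z := by
        refine lintegral_mono fun z => ?_
        dsimp only
        by_cases hz : z ∈ Metric.ball u.1 R
        · rw [Set.indicator_of_mem hz, ← Real.volume_ball (g z)]
          refine measure_mono fun t ht => ?_
          rw [Metric.mem_ball, Real.dist_eq]
          exact ht.2
        · have : Prod.mk z ⁻¹' E = ∅ := Set.eq_empty_of_forall_notMem fun t ht => hz ht.1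
          simp [this]
    _ = ENNReal.ofReal (2 * R ^ 2) * volume (Metric.ball u.1 R) :=
        lintegral_indicator_const measurableSet_ball _
    _ = ENNReal.ofReal (2 * R ^ 2) * (ENNReal.ofReal (R ^ 2 * Real.pi)) ^ n := by
        rw [volume_pi, Measure.pi_ball _ _ hR]
        simp only [Complex.volume_ball, Finset.prod_const, Finset.card_univ, Fintype.card_fin]
        congr 2
        rw [ENNReal.ofReal_mul (by positivity), ENNReal.ofReal_pow hR.le]
        congr 1
        exact (ENNReal.ofReal_coe_nnreal (p := NNReal.pi)).symm
    _ ≤ ENNReal.ofReal (2 * Real.pi ^ n * R ^ (2 * n + 2 : ℝ)) := by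
        rw [← ENNReal.ofReal_pow (by positivity), ← ENNReal.ofReal_mul (by positivity)]
        refine ENNReal.ofReal_le_ofReal (le_of_eq ?_)
        have : R ^ (2 * n + 2 : ℝ) = R ^ (2 * n + 2) := by
          rw [← Real.rpow_natCast]
          push_cast
          rfl
        rw [this]
        ring

lemma isHomogeneousGauge_Hnorm :
    IsHomogeneousGauge (volume : Measure (Hn n)) (2 * n + 2 : ℝ) (2 * Real.pi ^ n) Hnorm Hdist where
  measurable := continuous_Hdist.measurable
  gauge_bound := by
    have h : (Hnorm : Hn n → ℝ) = Hdist 0 := funext fun v => (Hdist_zero_left v).symm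
    rw [h]
    exact hasBallBound_Hdist 0
  ball_bound := hasBallBound_Hdist
  symm := Hdist_comm
  nonneg _ _ := Hnorm_nonneg _
  gauge_le := Hnorm_le
  dist_le := Hdist_le

end Heisenberg

/-- **Stein–Weiss inequality with full weights on the Heisenberg group** (Theorem D). -/
theorem stein_weiss_heisenberg_full_weights
    (n : ℕ) (hn : 1 ≤ n) (Q p p' q q' lam α β : ℝ) (hQ : Q = 2 * n + 2)
    (hp : 1 < p) (hq' : 1 < q')
    (hq : 1 / q + 1 / q' = 1) (hp' : 1 / p + 1 / p' = 1)
    (hlam0 : 0 < lam) (hlamQ : lam < Q)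
    (hab : 0 ≤ α + β) (habQ : lam + α + β ≤ Q)
    (hβ : β < Q / p') (hα : α < Q / q)
    (hbal : 1 / p + 1 / q' + (lam + α + β) / Q = 2) :
    ∃ C : ℝ, 0 < C ∧ ∀ f g : Hn n → ℝ,
      MemLp f (ENNReal.ofReal q') volume → MemLp g (ENNReal.ofReal p) volume →
      ∫⁻ u, ∫⁻ v, ENNReal.ofReal
          (|f u| * |g v| / (Hnorm u ^ α * Hdist u v ^ lam * Hnorm v ^ β)) ≤
        ENNReal.ofReal C * eLpNorm f (ENNReal.ofReal q') volume *
          eLpNorm g (ENNReal.ofReal p) volume := by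
  have hQ0 : 0 < Q := by rw [hQ]; positivity
  have hgauge : IsHomogeneousGauge (volume : Measure (Hn n)) Q (2 * Real.pi ^ n) Hnorm Hdist := by
    rw [hQ]
    exact isHomogeneousGauge_Hnorm
  have hpr : 1 ≤ 1 / p + 1 / q' := by
    have : (lam + α + β) / Q ≤ 1 := (div_le_one hQ0).2 habQ
    linarith
  have hα' : α < Q * (1 - 1 / q') := by
    have e : 1 - 1 / q' = 1 / q := by linarith
    rw [e, mul_one_div]
    exact hα
  have hβ' : β < Q * (1 - 1 / p) := by
    have e : 1 - 1 / p = 1 / p' := by linarith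
    rw [e, mul_one_div]
    exact hβ
  have hlam : lam + (α + β) = Q * (2 - 1 / p - 1 / q') := by
    rw [← hbal]
    field_simp
    ring
  obtain ⟨C, hC, h⟩ := kernelBounded_stein_weiss hQ0 (by positivity) hgauge hp hq' hpr hlamQ
    hab hα' hβ' hlam
  refine ⟨C.toReal + 1, by positivity, fun f g hf hg => ?_⟩
  have hCle : C ≤ ENNReal.ofReal (C.toReal + 1) := by
    rw [ENNReal.ofReal_add ENNReal.toReal_nonneg zero_le_one, ENNReal.ofReal_toReal hC]
    exact le_self_add
  set F : Hn n → ℝ≥0∞ := fun u => ‖hf.1.mk f u‖ₑ with hF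
  set G : Hn n → ℝ≥0∞ := fun v => ‖hg.1.mk g v‖ₑ with hG
  have hFm : Measurable F := hf.1.stronglyMeasurable_mk.enorm
  have hGm : Measurable G := hg.1.stronglyMeasurable_mk.enorm
  have norm_eq : ∀ (s : ℝ) (k : Hn n → ℝ) (hk : MemLp k (ENNReal.ofReal s) volume), 1 < s →
      (∫⁻ u, ‖hk.1.mk k u‖ₑ ^ s) ^ (1 / s) = eLpNorm k (ENNReal.ofReal s) volume := by
    intro s k hk hs
    have h1 := eLpNorm_eq_lintegral_rpow_enorm_toReal (f := hk.1.mk k) (μ := volume)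
      (p := ENNReal.ofReal s) (by simp; linarith) ENNReal.ofReal_ne_top
    rw [ENNReal.toReal_ofReal (by linarith)] at h1
    exact h1.symm.trans (eLpNorm_congr_ae hk.1.ae_eq_mk).symm
  have fin : ∀ (s : ℝ) (k : Hn n → ℝ) (hk : MemLp k (ENNReal.ofReal s) volume), 1 < s →
      ∫⁻ u, ‖hk.1.mk k u‖ₑ ^ s ≠ ⊤ := by
    intro s k hk hs htop
    have := norm_eq s k hk hs
    rw [htop, ENNReal.top_rpow_of_pos (by positivity)] at this
    exact hk.2.ne this.symm
  have key := h F G hFm hGm (fin q' f hf hq') (fin p g hg hp)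
  rw [norm_eq q' f hf hq', norm_eq p g hg hp] at key
  set K : Hn n × Hn n → ℝ≥0∞ :=
    {z : Hn n × Hn n | 0 < Hnorm z.1 ∧ 0 < Hnorm z.2 ∧ 0 < Hdist z.1 z.2}.indicator
      fun z => ENNReal.ofReal (Hnorm z.1 ^ (-α) * Hdist z.1 z.2 ^ (-lam) * Hnorm z.2 ^ (-β)) with hK
  have hm1 : Measurable fun z : Hn n × Hn n => Hnorm z.1 :=
    hgauge.gauge_bound.measurable.comp measurable_fst
  have hm2 : Measurable fun z : Hn n × Hn n => Hnorm z.2 :=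
    hgauge.gauge_bound.measurable.comp measurable_snd
  have hKm : Measurable K :=
    (((hm1.pow_const _).mul (hgauge.measurable.pow_const _)).mul
      (hm2.pow_const _)).ennreal_ofReal.indicator
      ((measurableSet_lt measurable_const hm1).inter ((measurableSet_lt measurable_const hm2).inter
      (measurableSet_lt measurable_const hgauge.measurable)))
  have hFGK : Measurable fun z : Hn n × Hn n => F z.1 * G z.2 * K z :=
    ((hFm.comp measurable_fst).mul (hGm.comp measurable_snd)).mul hKm
  calc ∫⁻ u, ∫⁻ v, ENNReal.ofReal
          (|f u| * |g v| / (Hnorm u ^ α * Hdist u v ^ lam * Hnorm v ^ β))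
      ≤ ∫⁻ u, ∫⁻ v, F u * G v * K (u, v) := by
        refine lintegral_mono_ae ?_
        filter_upwards [hf.1.ae_eq_mk, hgauge.gauge_bound.ae_pos hQ0] with u hfu hu
        refine lintegral_mono_ae ?_
        filter_upwards [hg.1.ae_eq_mk, hgauge.gauge_bound.ae_pos hQ0,
          (hgauge.ball_bound u).ae_pos hQ0] with v hgv hv huv
        have hmem : (u, v) ∈ {z : Hn n × Hn n |
            0 < Hnorm z.1 ∧ 0 < Hnorm z.2 ∧ 0 < Hdist z.1 z.2} := ⟨hu, hv, huv⟩
        simp only [hF, hG, hK]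
        rw [Set.indicator_of_mem hmem, ← hfu, ← hgv, Real.enorm_eq_ofReal_abs,
          Real.enorm_eq_ofReal_abs, ← ENNReal.ofReal_mul (abs_nonneg _),
          ← ENNReal.ofReal_mul (by positivity)]
        refine ENNReal.ofReal_le_ofReal (le_of_eq ?_)
        rw [Real.rpow_neg hu.le, Real.rpow_neg hv.le, Real.rpow_neg huv.le, div_eq_mul_inv,
          mul_inv, mul_inv]
    _ = ∫⁻ z, F z.1 * G z.2 * K z ∂(volume.prod volume) :=
        (lintegral_prod _ hFGK.aemeasurable).symm
    _ ≤ C * eLpNorm f (ENNReal.ofReal q') volume * eLpNorm g (ENNReal.ofReal p) volume := key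
    _ ≤ _ := by gcongr
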